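/- Let S be a finite nonempty set of trajectories, let s ∈ S, and let r > 0. If diam({s,a}) ≤ r for every a ∈ S, then diam(S) ≤ (2 + √2)·r. -/

import Mathlib

noncomputable section

/-- Position at time `t` of the trajectory `(a, v)`, i.e. `a + v*t`. -/
def trajPos (s : ℝ × ℝ) (t : ℝ) : ℝ := s.1 + s.2 * t

/-- Diameter of a finite set of trajectories: the integral over `[0,1]` of the
width of the set of positions; `0` for the empty set. -/
noncomputable def kdiam (C : Finset (ℝ × ℝ)) : ℝ :=
  if h : C.Nonempty then
    ∫ t in (0:ℝ)..1,
      (C.sup' h (fun s => trajPos s t) - C.inf' h (fun s => trajPos s t))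
  else 0

/-- A `k`-clustering of `S`: pairwise disjoint (possibly empty) clusters
indexed by `Fin k` whose union is `S`. -/
def IsClustering (S : Finset (ℝ × ℝ)) (k : ℕ) (𝒞 : Fin k → Finset (ℝ × ℝ)) : Prop :=
  (∀ i j : Fin k, i ≠ j → Disjoint (𝒞 i) (𝒞 j)) ∧
  Finset.univ.biUnion 𝒞 = S

/-- Sum of the diameters of the clusters. -/
noncomputable def sd {k : ℕ} (𝒞 : Fin k → Finset (ℝ × ℝ)) : ℝ :=
  ∑ i, kdiam (𝒞 i)

/-- Maximum diameter of a cluster. -/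
noncomputable def md {k : ℕ} (𝒞 : Fin k → Finset (ℝ × ℝ)) : ℝ :=
  ⨆ i, kdiam (𝒞 i)

/-- An SD-optimal `k`-clustering: minimizes `sd` among all `k`-clusterings of `S`. -/
def SDOptimal (S : Finset (ℝ × ℝ)) (k : ℕ) (𝒞 : Fin k → Finset (ℝ × ℝ)) : Prop :=
  IsClustering S k 𝒞 ∧
  ∀ 𝒟 : Fin k → Finset (ℝ × ℝ), IsClustering S k 𝒟 → sd 𝒞 ≤ sd 𝒟

/-- Optimal value of the maximum diameter over all `k`-clusterings of `S`. -/
noncomputable def optmd (S : Finset (ℝ × ℝ)) (k : ℕ) : ℝ :=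
  sInf {x | ∃ 𝒞 : Fin k → Finset (ℝ × ℝ), IsClustering S k 𝒞 ∧ x = md 𝒞}

/-- The strip `{(x,t) : 0 ≤ t ≤ 1}`. -/
def strip : Set (ℝ × ℝ) := {p | 0 ≤ p.2 ∧ p.2 ≤ 1}

/-- The graph of a trajectory inside the strip. -/
def trajGraph (s : ℝ × ℝ) : Set (ℝ × ℝ) :=
  {p | 0 ≤ p.2 ∧ p.2 ≤ 1 ∧ p.1 = trajPos s p.2}

/-- The strip minus the union of the graphs of the trajectories of `S`. -/
def freeRegion (S : Finset (ℝ × ℝ)) : Set (ℝ × ℝ) :=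
  strip \ ⋃ s ∈ S, trajGraph s

/-- A hole of `S`: a connected component of the strip minus the graphs. -/
def IsHole (S : Finset (ℝ × ℝ)) (h : Set (ℝ × ℝ)) : Prop :=
  ∃ p ∈ freeRegion S, h = connectedComponentIn (freeRegion S) p

/-- `s` is to the left of the hole `h`. -/
def LeftOf (s : ℝ × ℝ) (h : Set (ℝ × ℝ)) : Prop :=
  ∃ p ∈ h, trajPos s p.2 < p.1

open Classical in
/-- The trajectories of `S` to the left of `h`. -/
noncomputable def Sleft (S : Finset (ℝ × ℝ)) (h : Set (ℝ × ℝ)) : Finset (ℝ × ℝ) :=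
  S.filter (fun s => LeftOf s h)

open Classical in
/-- The trajectories of `S` to the right of `h`. -/
noncomputable def Sright (S : Finset (ℝ × ℝ)) (h : Set (ℝ × ℝ)) : Finset (ℝ × ℝ) :=
  S.filter (fun s => ¬ LeftOf s h)

/-- The hole `h` separates the clusters `A` and `B`. -/
def Separates (S : Finset (ℝ × ℝ)) (h : Set (ℝ × ℝ))
    (A B : Finset (ℝ × ℝ)) : Prop :=
  (A ⊆ Sleft S h ∧ B ⊆ Sright S h) ∨ (B ⊆ Sleft S h ∧ A ⊆ Sright S h)

/-- The span of a cluster: the region of the strip between its left and right sides. -/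
noncomputable def cspan (C : Finset (ℝ × ℝ)) : Set (ℝ × ℝ) :=
  if h : C.Nonempty then
    {p | 0 ≤ p.2 ∧ p.2 ≤ 1 ∧
      C.inf' h (fun s => trajPos s p.2) ≤ p.1 ∧
      p.1 ≤ C.sup' h (fun s => trajPos s p.2)}
  else ∅

/-- A hole is covered by a clustering if it is contained in the span of some cluster. -/
def Covered {k : ℕ} (𝒞 : Fin k → Finset (ℝ × ℝ)) (h : Set (ℝ × ℝ)) : Prop :=
  ∃ i, h ⊆ cspan (𝒞 i)

/-- A well-separated clustering: every two distinct nonempty clusters are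
separated by some uncovered hole. -/
def WellSeparated (S : Finset (ℝ × ℝ)) (k : ℕ)
    (𝒞 : Fin k → Finset (ℝ × ℝ)) : Prop :=
  IsClustering S k 𝒞 ∧
  ∀ i j : Fin k, i ≠ j → (𝒞 i).Nonempty → (𝒞 j).Nonempty →
    ∃ h, IsHole S h ∧ ¬ Covered 𝒞 h ∧ Separates S h (𝒞 i) (𝒞 j)

end

/-- The positions of two trajectories differ by the position of their difference. -/
theorem trajPos_sub (a s : ℝ × ℝ) (t : ℝ) :
    trajPos a t - trajPos s t = trajPos (a - s) t := by
  simp only [trajPos, Prod.fst_sub, Prod.snd_sub]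
  ring

@[fun_prop]
theorem continuous_trajPos (s : ℝ × ℝ) : Continuous (trajPos s) := by
  unfold trajPos
  fun_prop

theorem integral_trajPos (s : ℝ × ℝ) (x y : ℝ) :
    ∫ t in x..y, trajPos s t = s.1 * (y - x) + s.2 * ((y ^ 2 - x ^ 2) / 2) := by
  unfold trajPos
  rw [intervalIntegral.integral_add (by simp) (by apply Continuous.intervalIntegrable; fun_prop),
    intervalIntegral.integral_const, intervalIntegral.integral_const_mul, integral_id, smul_eq_mul]
  ring

/-- The diameter of a pair of trajectories is the `L¹` distance of their positions. -/
theorem kdiam_pair (s a : ℝ × ℝ) :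
    kdiam {s, a} = ∫ t in (0:ℝ)..1, |trajPos (a - s) t| := by
  have h : ({s, a} : Finset (ℝ × ℝ)).Nonempty := Finset.insert_nonempty _ _
  rw [kdiam, dif_pos h]
  refine intervalIntegral.integral_congr fun t _ => ?_
  rw [Finset.sup'_insert (H := Finset.singleton_nonempty a),
    Finset.inf'_insert (H := Finset.singleton_nonempty a), Finset.sup'_singleton,
    Finset.inf'_singleton, max_sub_min_eq_abs, trajPos_sub]

/-- Testing the `L¹` norm of an affine function against the sign function jumping at `c`. -/
theorem le_integral_abs_trajPos (d : ℝ × ℝ) {c : ℝ} (h0 : 0 ≤ c) (h1 : c ≤ 1) :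
    |d.1 * (1 - 2 * c) + d.2 * ((1 - 2 * c ^ 2) / 2)| ≤ ∫ t in (0:ℝ)..1, |trajPos d t| := by
  have hint (x y : ℝ) : IntervalIntegrable (fun t => |trajPos d t|) MeasureTheory.volume x y := by
    apply Continuous.intervalIntegrable
    fun_prop
  rw [← intervalIntegral.integral_add_adjacent_intervals (hint 0 c) (hint c 1)]
  have hl := intervalIntegral.abs_integral_le_integral_abs (f := trajPos d)
    (μ := MeasureTheory.volume) h0
  have hr := intervalIntegral.abs_integral_le_integral_abs (f := trajPos d)
    (μ := MeasureTheory.volume) h1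
  rw [integral_trajPos] at hl hr
  rw [abs_le] at hl hr ⊢
  constructor <;> linarith

/-- An affine function of `L¹` norm at most `r` on the unit interval is bounded by `r` at the
midpoint and by `(1 + √2) r` at the endpoints, hence by the piecewise linear interpolation. -/
theorem abs_trajPos_le {d : ℝ × ℝ} {r : ℝ} (hd : ∫ t in (0:ℝ)..1, |trajPos d t| ≤ r)
    {t : ℝ} (ht : t ∈ Set.Icc (0:ℝ) 1) :
    |trajPos d t| ≤ r * (1 + √2 * |2 * t - 1|) := by
  have hsq : √2 ^ 2 = 2 := Real.sq_sqrt (by norm_num)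
  have hpos : 0 ≤ √2 := Real.sqrt_nonneg 2
  have hlt : 1 < √2 := by nlinarith
  have hlt' : √2 < 2 := by nlinarith
  have hmid := (le_integral_abs_trajPos d le_rfl zero_le_one).trans hd
  have hright := (le_integral_abs_trajPos d (c := 1 - √2 / 2) (by linarith) (by linarith)).trans hd
  have hleft := (le_integral_abs_trajPos d (c := √2 / 2) (by linarith) (by linarith)).trans hd
  have er : d.1 * (1 - 2 * (1 - √2 / 2)) + d.2 * ((1 - 2 * (1 - √2 / 2) ^ 2) / 2)
      = (√2 - 1) * (d.1 + d.2) := by linear_combination (-d.2 / 4) * hsq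
  have el : d.1 * (1 - 2 * (√2 / 2)) + d.2 * ((1 - 2 * (√2 / 2) ^ 2) / 2)
      = -((√2 - 1) * d.1) := by linear_combination (-d.2 / 4) * hsq
  have scale {x : ℝ} (hx : |(√2 - 1) * x| ≤ r) : |x| ≤ (1 + √2) * r := by
    rw [abs_mul, abs_of_pos (by linarith)] at hx
    linear_combination (1 + √2) * hx - |x| * hsq
  rw [er] at hright
  rw [el, abs_neg] at hleft
  have hright := abs_le.1 (scale hright)
  have hleft := abs_le.1 (scale hleft)
  have hmid := abs_le.1 hmid
  obtain ⟨ht0, ht1⟩ := ht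
  rw [trajPos]
  rcases le_total (2 * t) 1 with h | h
  · rw [abs_of_nonpos (a := 2 * t - 1) (by linarith), abs_le]
    constructor <;> nlinarith [mul_nonneg ht0 (sub_nonneg.2 hmid.1),
      mul_nonneg ht0 (sub_nonneg.2 hmid.2),
      mul_nonneg (sub_nonneg.2 h) (sub_nonneg.2 hleft.1),
      mul_nonneg (sub_nonneg.2 h) (sub_nonneg.2 hleft.2)]
  · rw [abs_of_nonneg (a := 2 * t - 1) (by linarith), abs_le]
    constructor <;> nlinarith [mul_nonneg (sub_nonneg.2 ht1) (sub_nonneg.2 hmid.1),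
      mul_nonneg (sub_nonneg.2 ht1) (sub_nonneg.2 hmid.2),
      mul_nonneg (sub_nonneg.2 h) (sub_nonneg.2 hright.1),
      mul_nonneg (sub_nonneg.2 h) (sub_nonneg.2 hright.2)]

theorem integral_abs_two_mul_sub_one : ∫ t in (0:ℝ)..1, |2 * t - 1| = 1 / 2 := by
  have h := intervalIntegral.integral_comp_mul_sub (a := 0) (b := 1) (fun x : ℝ => |x|)
    (two_ne_zero) 1
  rw [h]
  have hint (x y : ℝ) : IntervalIntegrable (fun t : ℝ => |t|) MeasureTheory.volume x y :=
    continuous_abs.intervalIntegrable x y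
  norm_num
  rw [← intervalIntegral.integral_add_adjacent_intervals (hint (-1) 0) (hint 0 1)]
  have e1 : ∫ t in (-1:ℝ)..0, |t| = ∫ t in (-1:ℝ)..0, -t :=
    intervalIntegral.integral_congr fun t ht => by
      rw [Set.uIcc_of_le (by norm_num)] at ht
      exact abs_of_nonpos ht.2
  have e2 : ∫ t in (0:ℝ)..1, |t| = ∫ t in (0:ℝ)..1, t :=
    intervalIntegral.integral_congr fun t ht => by
      rw [Set.uIcc_of_le zero_le_one] at ht
      exact abs_of_nonneg ht.1
  rw [e1, e2, intervalIntegral.integral_neg, integral_id, integral_id]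
  norm_num

/-- if all trajectories of `S` are within pairwise diameter `r`
of `s ∈ S`, then `diam S ≤ (2 + √2) r`. -/
theorem stmt10 (S : Finset (ℝ × ℝ)) (hS : S.Nonempty) (s : ℝ × ℝ) (hs : s ∈ S)
    (r : ℝ) (hr : 0 < r) (hball : ∀ a ∈ S, kdiam {s, a} ≤ r) :
    kdiam S ≤ (2 + Real.sqrt 2) * r := by
  have hpt (t : ℝ) (ht : t ∈ Set.Icc (0:ℝ) 1) :
      S.sup' hS (fun a => trajPos a t) - S.inf' hS (fun a => trajPos a t)
        ≤ 2 * r * (1 + √2 * |2 * t - 1|) := by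
    have hb (a : ℝ × ℝ) (ha : a ∈ S) :
        |trajPos a t - trajPos s t| ≤ r * (1 + √2 * |2 * t - 1|) := by
      rw [trajPos_sub]
      exact abs_trajPos_le (kdiam_pair s a ▸ hball a ha) ht
    have hsup : S.sup' hS (fun a => trajPos a t)
        ≤ trajPos s t + r * (1 + √2 * |2 * t - 1|) :=
      Finset.sup'_le _ _ fun a ha => by linarith [(abs_le.1 (hb a ha)).2]
    have hinf : trajPos s t - r * (1 + √2 * |2 * t - 1|)
        ≤ S.inf' hS (fun a => trajPos a t) :=
      Finset.le_inf' _ _ fun a ha => by linarith [(abs_le.1 (hb a ha)).1]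
    linarith
  have hcont : Continuous fun t =>
      S.sup' hS (fun a => trajPos a t) - S.inf' hS (fun a => trajPos a t) :=
    (Continuous.finset_sup'_apply hS fun a _ => continuous_trajPos a).sub
      (Continuous.finset_inf'_apply hS fun a _ => continuous_trajPos a)
  rw [kdiam, dif_pos hS]
  calc ∫ t in (0:ℝ)..1, (S.sup' hS (fun a => trajPos a t) - S.inf' hS (fun a => trajPos a t))
      ≤ ∫ t in (0:ℝ)..1, 2 * r * (1 + √2 * |2 * t - 1|) :=
        intervalIntegral.integral_mono_on zero_le_one (hcont.intervalIntegrable 0 1)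
          (Continuous.intervalIntegrable (by fun_prop) 0 1) hpt
    _ = (2 + √2) * r := by
        rw [intervalIntegral.integral_const_mul, intervalIntegral.integral_add (by simp)
            (Continuous.intervalIntegrable (by fun_prop) 0 1),
          intervalIntegral.integral_const_mul, integral_abs_two_mul_sub_one]
        simp
        ring
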